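/- arXiv:1606.04198 — 7 statements merged into one kernel-verified Lean document; each statement's English description precedes it below -/
import Mathlib

section
/- Let K be a positive integer and let c₁, …, c_K be nonnegative real numbers. The function f : ℝ^K → ℝ defined by f(p) = (∑_{i=1}^{K} c_i·√(p_i))² is concave on the nonnegative orthant {p ∈ ℝ^K : p_i ≥ 0 for all i}. -/
/-- Joint concavity of the geometric mean `√x * √y`, as an inequality. -/
theorem Real.add_mul_sqrt_mul_sqrt_le {a b x y u v : ℝ} (ha : 0 ≤ a) (hb : 0 ≤ b)
    (hx : 0 ≤ x) (hy : 0 ≤ y) (hu : 0 ≤ u) (hv : 0 ≤ v) :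
    a * (√x * √y) + b * (√u * √v) ≤ √(a * x + b * u) * √(a * y + b * v) := by
  rw [← Real.sqrt_mul (x := a * x + b * u) (by positivity)]
  apply Real.le_sqrt_of_sq_le
  calc (a * (√x * √y) + b * (√u * √v)) ^ 2
      ≤ (a * √x ^ 2 + b * √u ^ 2) * (a * √y ^ 2 + b * √v ^ 2) := by
        linarith [mul_nonneg (mul_nonneg ha hb) (sq_nonneg (√x * √v - √u * √y))]
    _ = (a * x + b * u) * (a * y + b * v) := by
        rw [Real.sq_sqrt hx, Real.sq_sqrt hy, Real.sq_sqrt hu, Real.sq_sqrt hv]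

open Finset in
/-- The received-signal power `p ↦ (∑ i, c i * √(p i))²` is concave on the
nonnegative orthant, for nonnegative coefficients `c`. -/
theorem signal_power_concaveOn (K : ℕ) (hK : 0 < K) (c : Fin K → ℝ)
    (hc : ∀ i, 0 ≤ c i) :
    ConcaveOn ℝ {p : Fin K → ℝ | ∀ i, 0 ≤ p i}
      (fun p : Fin K → ℝ => (∑ i, c i * Real.sqrt (p i)) ^ 2) := by
  refine ⟨convex_Ici (0 : Fin K → ℝ), fun p hp q hq a b ha hb _ => ?_⟩
  simp only [smul_eq_mul, Pi.add_apply, Pi.smul_apply, sq, sum_mul_sum]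
  simp only [mul_sum, ← sum_add_distrib]
  refine sum_le_sum fun i _ => sum_le_sum fun j _ => ?_
  linarith [mul_le_mul_of_nonneg_left
    (Real.add_mul_sqrt_mul_sqrt_le ha hb (hp i) (hp j) (hq i) (hq j))
    (mul_nonneg (hc i) (hc j))]
end

section
/- Let K be a positive integer, c₁, …, c_K ≥ 0, and e > 0. The function f : ℝ^K → ℝ defined by f(p) = log(1 + (∑_{i=1}^{K} c_i·√(p_i))² / e) is concave on the nonnegative orthant {p ∈ ℝ^K : p_i ≥ 0 for all i}. -/
/-- The geometric mean is concave on the closed quadrant. -/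
theorem concaveOn_sqrt_mul_sqrt {E : Type*} [AddCommGroup E] [Module ℝ E] {s : Set E}
    (hs : Convex ℝ s) (f g : E →ₗ[ℝ] ℝ) (hf : ∀ p ∈ s, 0 ≤ f p) (hg : ∀ p ∈ s, 0 ≤ g p) :
    ConcaveOn ℝ s (fun p => √(f p) * √(g p)) := by
  refine ⟨hs, fun p hp q hq a b ha hb hab => ?_⟩
  have hfm := hf _ (hs hp hq ha hb hab)
  simp only [smul_eq_mul]
  rw [← Real.sqrt_mul hfm]
  apply Real.le_sqrt_of_sq_le
  simp only [map_add, map_smul, smul_eq_mul]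
  have h₁ := Real.sq_sqrt (hf p hp)
  have h₂ := Real.sq_sqrt (hf q hq)
  have h₃ := Real.sq_sqrt (hg p hp)
  have h₄ := Real.sq_sqrt (hg q hq)
  generalize √(f p) = u at *
  generalize √(f q) = v at *
  generalize √(g p) = w at *
  generalize √(g q) = z at *
  rw [← h₁, ← h₂, ← h₃, ← h₄]
  nlinarith [mul_nonneg (mul_nonneg ha hb) (sq_nonneg (u * z - v * w))]

theorem convex_nonneg_orthant (ι : Type*) : Convex ℝ {p : ι → ℝ | ∀ i, 0 ≤ p i} :=
  convex_Ici (0 : ι → ℝ)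

/-- The square of a nonnegative combination of square roots is concave on the orthant. -/
theorem concaveOn_sum_mul_sqrt_sq {ι : Type*} [Fintype ι] (c : ι → ℝ) (hc : ∀ i, 0 ≤ c i) :
    ConcaveOn ℝ {p : ι → ℝ | ∀ i, 0 ≤ p i} (fun p => (∑ i, c i * √(p i)) ^ 2) := by
  have hterm (i j : ι) : ConcaveOn ℝ {p : ι → ℝ | ∀ i, 0 ≤ p i}
      (fun p => c i * c j * (√(p i) * √(p j))) :=
    (concaveOn_sqrt_mul_sqrt (convex_nonneg_orthant ι) (LinearMap.proj i) (LinearMap.proj j)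
      (fun _ hp => hp i) (fun _ hp => hp j)).smul (mul_nonneg (hc i) (hc j))
  refine ⟨convex_nonneg_orthant ι, fun p hp q hq a b ha hb hab => ?_⟩
  simp only [sq, Finset.sum_mul_sum, smul_eq_mul]
  simp only [Finset.mul_sum, ← Finset.sum_add_distrib]
  refine Finset.sum_le_sum fun i _ => Finset.sum_le_sum fun j _ => ?_
  have h := (hterm i j).2 hp hq ha hb hab
  simp only [smul_eq_mul] at h
  linarith

open Finset in
/-- The per-subcarrier rate `p ↦ log(1 + (∑ i, c i * √(p i))² / e)` is concave on the
nonnegative orthant, for nonnegative coefficients `c` and positive noise power `e`. -/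
theorem rate_concaveOn (K : ℕ) (hK : 0 < K) (c : Fin K → ℝ) (hc : ∀ i, 0 ≤ c i)
    (e : ℝ) (he : 0 < e) :
    ConcaveOn ℝ {p : Fin K → ℝ | ∀ i, 0 ≤ p i}
      (fun p : Fin K → ℝ => Real.log (1 + (∑ i, c i * Real.sqrt (p i)) ^ 2 / e)) := by
  refine ⟨convex_nonneg_orthant _, fun p hp q hq a b ha hb hab => ?_⟩
  have hpos (r : Fin K → ℝ) : 0 < 1 + (∑ i, c i * √(r i)) ^ 2 / e := by positivity
  refine (strictConcaveOn_log_Ioi.concaveOn.2 (hpos p) (hpos q) ha hb hab).trans ?_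
  refine Real.log_le_log (convex_Ioi (0 : ℝ) (hpos p) (hpos q) ha hb hab) ?_
  have h := div_le_div_of_nonneg_right
    ((concaveOn_sum_mul_sqrt_sq c hc).2 hp hq ha hb hab) he.le
  simp only [smul_eq_mul, add_div, mul_div_assoc] at h ⊢
  linarith
end

section
/- Let K and L be positive integers, W > 0, let c_{ik} ≥ 0 for 1 ≤ i ≤ K and 1 ≤ k ≤ L, and let e_k > 0 for 1 ≤ k ≤ L. The cloud utility function U : ℝ^{K×L} → ℝ defined by U(p) = ∑_{k=1}^{L} (W/L)·log(1 + (∑_{i=1}^{K} c_{ik}·√(p_{ik}))² / e_k) is concave on the nonnegative orthant {p ∈ ℝ^{K×L} : p_{ik} ≥ 0 for all i, k}. -/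
theorem mul_sqrt_mul_sqrt_add_le {a b x y u v : ℝ} (ha : 0 ≤ a) (hb : 0 ≤ b)
    (hx : 0 ≤ x) (hy : 0 ≤ y) (hu : 0 ≤ u) (hv : 0 ≤ v) :
    a * (√x * √u) + b * (√y * √v) ≤ √(a * x + b * y) * √(a * u + b * v) := by
  rw [← Real.sqrt_mul (x := a * x + b * y) (by positivity)]
  apply Real.le_sqrt_of_sq_le
  obtain ⟨x, hx₀, rfl⟩ : ∃ r, 0 ≤ r ∧ r ^ 2 = x := ⟨√x, Real.sqrt_nonneg x, Real.sq_sqrt hx⟩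
  obtain ⟨y, hy₀, rfl⟩ : ∃ r, 0 ≤ r ∧ r ^ 2 = y := ⟨√y, Real.sqrt_nonneg y, Real.sq_sqrt hy⟩
  obtain ⟨u, hu₀, rfl⟩ : ∃ r, 0 ≤ r ∧ r ^ 2 = u := ⟨√u, Real.sqrt_nonneg u, Real.sq_sqrt hu⟩
  obtain ⟨v, hv₀, rfl⟩ : ∃ r, 0 ≤ r ∧ r ^ 2 = v := ⟨√v, Real.sqrt_nonneg v, Real.sq_sqrt hv⟩
  simp only [Real.sqrt_sq, hx₀, hy₀, hu₀, hv₀]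
  nlinarith [mul_nonneg (mul_nonneg ha hb) (sq_nonneg (x * v - y * u))]

theorem concaveOn_sq_sum_mul_sqrt {ι : Type*} [Fintype ι] {c : ι → ℝ} (hc : ∀ i, 0 ≤ c i) :
    ConcaveOn ℝ {x : ι → ℝ | ∀ i, 0 ≤ x i} (fun x => (∑ i, c i * √(x i)) ^ 2) := by
  refine ⟨convex_Ici (0 : ι → ℝ), fun x hx y hy a b ha hb _ => ?_⟩
  simp only [sq, Finset.sum_mul_sum, smul_eq_mul, Pi.add_apply, Pi.smul_apply]
  simp only [Finset.mul_sum, ← Finset.sum_add_distrib]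
  gcongr with i _ j _
  have h := mul_le_mul_of_nonneg_left
    (mul_sqrt_mul_sqrt_add_le ha hb (hx i) (hy i) (hx j) (hy j)) (mul_nonneg (hc i) (hc j))
  linarith

theorem ConcaveOn.log {E : Type*} [AddCommMonoid E] [Module ℝ E] {s : Set E} {f : E → ℝ}
    (hf : ConcaveOn ℝ s f) (hpos : ∀ x ∈ s, 0 < f x) :
    ConcaveOn ℝ s (fun x => Real.log (f x)) := by
  refine ⟨hf.1, fun x hx y hy a b ha hb hab => ?_⟩
  have hlog := strictConcaveOn_log_Ioi.concaveOn
  exact (hlog.2 (hpos x hx) (hpos y hy) ha hb hab).trans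
    (Real.log_le_log (hlog.1 (hpos x hx) (hpos y hy) ha hb hab) (hf.2 hx hy ha hb hab))


open Finset in
/-- The cloud utility `U(p) = ∑ k, (W/L) * log(1 + (∑ i, c i k * √(p i k))² / e k)`
is concave on the nonnegative orthant of `ℝ^{K×L}`. -/
theorem cloud_utility_concaveOn (K L : ℕ) (hK : 0 < K) (hL : 0 < L)
    (W : ℝ) (hW : 0 < W)
    (c : Fin K → Fin L → ℝ) (hc : ∀ i k, 0 ≤ c i k)
    (e : Fin L → ℝ) (he : ∀ k, 0 < e k) :
    ConcaveOn ℝ {p : Fin K → Fin L → ℝ | ∀ i k, 0 ≤ p i k}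
      (fun p : Fin K → Fin L → ℝ =>
        ∑ k, (W / (L : ℝ)) *
          Real.log (1 + (∑ i, c i k * Real.sqrt (p i k)) ^ 2 / e k)) := by
  have hconv : Convex ℝ {p : Fin K → Fin L → ℝ | ∀ i k, 0 ≤ p i k} :=
    convex_Ici (0 : Fin K → Fin L → ℝ)
  refine ⟨hconv, fun p hp q hq a b ha hb hab => ?_⟩
  simp only [smul_eq_mul, mul_sum, ← sum_add_distrib]
  refine sum_le_sum fun k _ => ?_
  have hsq := (concaveOn_sq_sum_mul_sqrt fun i => hc i k).smul (inv_nonneg.2 (he k).le)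
  have hlog := ((concaveOn_const (1 : ℝ) hsq.1).add hsq).log fun x _ => by
    have := he k
    simp only [Pi.add_apply, smul_eq_mul]
    positivity
  have h := (hlog.smul (by positivity : 0 ≤ W / (L : ℝ))).2
    (x := fun i => p i k) (fun i => hp i k) (y := fun i => q i k) (fun i => hq i k) ha hb hab
  simpa [div_eq_inv_mul] using h
end

section
/- Let a ≥ 0, b ≥ 0, and c > 0. The function f : ℝ → ℝ defined by f(x) = log(1 + a·x / (b·x + c)) is concave on the half-line [0, ∞). -/
theorem concaveOn_mul_div_mul_add {a b c : ℝ} (ha : 0 ≤ a) (hb : 0 ≤ b) (hc : 0 < c) :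
    ConcaveOn ℝ (Set.Ici (0 : ℝ)) (fun x : ℝ => a * x / (b * x + c)) := by
  refine ⟨convex_Ici 0, fun x hx y hy p q hp hq hpq => ?_⟩
  have hm : 0 ≤ p • x + q • y := convex_Ici (0 : ℝ) hx hy hp hq hpq
  rw [Set.mem_Ici] at hx hy
  simp only [smul_eq_mul] at hm ⊢
  have hX : 0 < b * x + c := by positivity
  have hY : 0 < b * y + c := by positivity
  have hM : 0 < b * (p * x + q * y) + c := by positivity
  obtain rfl : q = 1 - p := by linarith
  rw [← sub_nonneg]
  have key : a * (p * x + (1 - p) * y) / (b * (p * x + (1 - p) * y) + c) -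
      (p * (a * x / (b * x + c)) + (1 - p) * (a * y / (b * y + c))) =
      a * b * c * p * (1 - p) * (x - y) ^ 2 /
        ((b * (p * x + (1 - p) * y) + c) * (b * x + c) * (b * y + c)) := by
    rw [eq_div_iff (by positivity)]
    field_simp
    ring
  rw [key]
  positivity

/-- The per-subcarrier rate `x ↦ log(1 + a·x / (b·x + c))` is concave on `[0, ∞)`
for `a ≥ 0`, `b ≥ 0`, `c > 0`. -/
theorem log_rate_concaveOn (a b c : ℝ) (ha : 0 ≤ a) (hb : 0 ≤ b) (hc : 0 < c) :
    ConcaveOn ℝ (Set.Ici (0 : ℝ))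
      (fun x : ℝ => Real.log (1 + a * x / (b * x + c))) := by
  have hpos : ∀ x ∈ Set.Ici (0 : ℝ), 0 < 1 + a * x / (b * x + c) := by
    intro x hx
    rw [Set.mem_Ici] at hx
    positivity
  have hconc := (concaveOn_const (𝕜 := ℝ) (1 : ℝ) (convex_Ici (0 : ℝ))).add
    (concaveOn_mul_div_mul_add ha hb hc)
  refine ⟨convex_Ici 0, fun x hx y hy p q hp hq hpq => ?_⟩
  have hlog := strictConcaveOn_log_Ioi.concaveOn
  refine (hlog.2 (hpos x hx) (hpos y hy) hp hq hpq).trans ?_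
  exact Real.log_le_log (hlog.1 (hpos x hx) (hpos y hy) hp hq hpq) (hconc.2 hx hy hp hq hpq)
end

section
/- Let L be a positive integer, W > 0, and for each 1 ≤ k ≤ L let c_k ≥ 0, D_k ≥ 0, and I_k > 0. The cognitive-hierarchy utility U : ℝ^L → ℝ defined by U(p) = ∑_{k=1}^{L} (W/L)·log(1 + c_k·p_k / (I_k + D_k·p_k)) is concave on the nonnegative orthant {p ∈ ℝ^L : p_k ≥ 0 for all k}. -/
/-- The fractional linear map `x ↦ x / (b + d * x)` is concave on `[0, ∞)`. -/
lemma concaveOn_div_add_mul {b d : ℝ} (hb : 0 < b) (hd : 0 ≤ d) :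
    ConcaveOn ℝ (Set.Ici 0) (fun x : ℝ => x / (b + d * x)) := by
  refine ⟨convex_Ici 0, fun x hx y hy s t hs ht hst => ?_⟩
  have hz : 0 ≤ s * x + t * y := add_nonneg (mul_nonneg hs hx) (mul_nonneg ht hy)
  have pos {u : ℝ} (hu : 0 ≤ u) : 0 < b + d * u := by positivity
  simp only [smul_eq_mul]
  set z := s * x + t * y with hzdef
  have hzpos := pos hz
  have tangent {u : ℝ} (hu : 0 ≤ u) :
      u / (b + d * u) ≤ z / (b + d * z) + b * (u - z) / (b + d * z) ^ 2 := by
    have hupos := pos hu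
    have key : z / (b + d * z) + b * (u - z) / (b + d * z) ^ 2 - u / (b + d * u)
        = b * d * (u - z) ^ 2 / ((b + d * z) ^ 2 * (b + d * u)) := by
      field_simp
      ring
    have : 0 ≤ b * d * (u - z) ^ 2 / ((b + d * z) ^ 2 * (b + d * u)) := by positivity
    linarith
  calc s * (x / (b + d * x)) + t * (y / (b + d * y))
      ≤ s * (z / (b + d * z) + b * (x - z) / (b + d * z) ^ 2)
        + t * (z / (b + d * z) + b * (y - z) / (b + d * z) ^ 2) := by
        gcongr
        · exact tangent hx
        · exact tangent hy
    _ = (s + t) * (z / (b + d * z))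
        + b * (s * x + t * y - (s + t) * z) / (b + d * z) ^ 2 := by ring
    _ = z / (b + d * z) := by rw [hst, ← hzdef]; ring

/-- The logarithm of a positive concave function is concave. -/
lemma ConcaveOn.log_of_pos {E : Type*} [AddCommGroup E] [Module ℝ E] {S : Set E} {f : E → ℝ}
    (hf : ConcaveOn ℝ S f) (hpos : ∀ x ∈ S, 0 < f x) :
    ConcaveOn ℝ S (fun x => Real.log (f x)) := by
  refine ⟨hf.1, fun x hx y hy s t hs ht hst => ?_⟩
  have hlog := strictConcaveOn_log_Ioi.concaveOn
  exact (hlog.2 (hpos x hx) (hpos y hy) hs ht hst).trans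
    (Real.log_le_log (hlog.1 (hpos x hx) (hpos y hy) hs ht hst) (hf.2 hx hy hs ht hst))

/-- The rate `x ↦ log (1 + a * x / (b + d * x))` is concave on `[0, ∞)`. -/
lemma concaveOn_log_one_add_div {a b d : ℝ} (ha : 0 ≤ a) (hb : 0 < b) (hd : 0 ≤ d) :
    ConcaveOn ℝ (Set.Ici 0) (fun x : ℝ => Real.log (1 + a * x / (b + d * x))) := by
  refine ConcaveOn.log_of_pos ?_ fun x (hx : 0 ≤ x) => by positivity
  simp only [mul_div_assoc]
  exact
    (concaveOn_const (1 : ℝ) (convex_Ici 0)).add ((concaveOn_div_add_mul hb hd).smul ha)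

open Finset in
/-- The cognitive-hierarchy utility
`U(p) = ∑ k, (W/L) * log(1 + c k * p k / (I k + D k * p k))` is concave on the
nonnegative orthant of `ℝ^L`. -/
theorem ch_utility_concaveOn (L : ℕ) (hL : 0 < L) (W : ℝ) (hW : 0 < W)
    (c D I : Fin L → ℝ) (hc : ∀ k, 0 ≤ c k) (hD : ∀ k, 0 ≤ D k)
    (hI : ∀ k, 0 < I k) :
    ConcaveOn ℝ {p : Fin L → ℝ | ∀ k, 0 ≤ p k}
      (fun p : Fin L → ℝ =>
        ∑ k, (W / (L : ℝ)) *
          Real.log (1 + c k * p k / (I k + D k * p k))) := by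
  have rate (k : Fin L) := concaveOn_log_one_add_div (hc k) (hI k) (hD k)
  refine ⟨convex_Ici (0 : Fin L → ℝ), fun x hx y hy s t hs ht hst => ?_⟩
  simp only [smul_eq_mul, mul_sum, ← sum_add_distrib]
  refine sum_le_sum fun k _ => ?_
  have hWL : 0 ≤ W / (L : ℝ) := by positivity
  exact ((rate k).smul hWL).2 (hx k) (hy k) hs ht hst
end

section
/- Let L be a positive integer, P > 0, and for each 1 ≤ k ≤ L let c_k > 0, D_k ≥ 0, and I_k > 0. Suppose p* ∈ ℝ^L satisfies p*_k ≥ 0 for all k and ∑_{k=1}^{L} p*_k = P, and suppose there exists μ > 0 such that: (i) for every k with p*_k > 0, c_k·I_k / ((I_k + D_k·p*_k)·(I_k + (c_k + D_k)·p*_k)) = μ, and (ii) for every k with p*_k = 0, c_k / I_k ≤ μ. Then p* maximizes the function q ↦ ∑_{k=1}^{L} log(1 + c_k·q_k / (I_k + D_k·q_k)) over the feasible set {q ∈ ℝ^L : q_k ≥ 0 for all k, ∑_{k=1}^{L} q_k ≤ P}. -/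
/-- The rate `x ↦ log (1 + c x / (I + D x))` lies below each of its tangent lines on `[0, ∞)`. -/
theorem log_rate_le_tangent {c D I x y : ℝ} (hc : 0 < c) (hD : 0 ≤ D) (hI : 0 < I)
    (hx : 0 ≤ x) (hy : 0 ≤ y) :
    Real.log (1 + c * y / (I + D * y)) ≤ Real.log (1 + c * x / (I + D * x)) +
      c * I / ((I + D * x) * (I + (c + D) * x)) * (y - x) := by
  have hAx : 0 < I + D * x := by positivity
  have hAy : 0 < I + D * y := by positivity
  have hBx : 0 < I + (c + D) * x := by positivity
  have hFx : 0 < 1 + c * x / (I + D * x) := by positivity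
  have hFy : 0 < 1 + c * y / (I + D * y) := by positivity
  have hlog := Real.log_le_sub_one_of_pos (div_pos hFy hFx)
  rw [Real.log_div hFy.ne' hFx.ne'] at hlog
  have hFx_eq : 1 + c * x / (I + D * x) = (I + (c + D) * x) / (I + D * x) := by
    field_simp
    ring
  have hgap : c * I / ((I + D * x) * (I + (c + D) * x)) * (y - x) -
      ((1 + c * y / (I + D * y)) / (1 + c * x / (I + D * x)) - 1) =
      c * I * D * (y - x) ^ 2 / ((I + D * x) * (I + D * y) * (I + (c + D) * x)) := by
    rw [hFx_eq]
    field_simp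
    ring
  have hgap_nonneg :
      0 ≤ c * I * D * (y - x) ^ 2 / ((I + D * x) * (I + D * y) * (I + (c + D) * x)) := by
    positivity
  linarith


open Finset in
/-- Sufficiency of the KKT conditions for the cognitive-hierarchy power allocation:
if `p*` is feasible with full budget use and there is a multiplier `μ > 0` with
stationarity on active subcarriers and the dual inequality on inactive ones, then
`p*` maximizes `q ↦ ∑ k, log(1 + c k * q k / (I k + D k * q k))` over the feasible set. -/
theorem ch_kkt_sufficient (L : ℕ) (hL : 0 < L) (P : ℝ) (hP : 0 < P)
    (c D I : Fin L → ℝ) (hc : ∀ k, 0 < c k) (hD : ∀ k, 0 ≤ D k)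
    (hI : ∀ k, 0 < I k)
    (p : Fin L → ℝ) (hp : ∀ k, 0 ≤ p k) (hsum : ∑ k, p k = P)
    (μ : ℝ) (hμ : 0 < μ)
    (hstat : ∀ k, 0 < p k →
      c k * I k / ((I k + D k * p k) * (I k + (c k + D k) * p k)) = μ)
    (hslack : ∀ k, p k = 0 → c k / I k ≤ μ) :
    ∀ q : Fin L → ℝ, (∀ k, 0 ≤ q k) → ∑ k, q k ≤ P →
      ∑ k, Real.log (1 + c k * q k / (I k + D k * q k)) ≤
        ∑ k, Real.log (1 + c k * p k / (I k + D k * p k)) := by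
  intro q hq hqsum
  have hterm (k : Fin L) : Real.log (1 + c k * q k / (I k + D k * q k)) ≤
      Real.log (1 + c k * p k / (I k + D k * p k)) + μ * (q k - p k) := by
    refine (log_rate_le_tangent (hc k) (hD k) (hI k) (hp k) (hq k)).trans ?_
    refine add_le_add_right ?_ _
    rcases (hp k).eq_or_lt with h0 | hpos
    · have hslope : c k * I k / (I k * I k) = c k / I k :=
        mul_div_mul_right _ _ (hI k).ne'
      simpa [← h0, hslope] using mul_le_mul_of_nonneg_right (hslack k h0.symm) (hq k)
    · rw [hstat k hpos]
  calc
    _ ≤ ∑ k, (Real.log (1 + c k * p k / (I k + D k * p k)) + μ * (q k - p k)) :=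
      sum_le_sum fun k _ => hterm k
    _ = ∑ k, Real.log (1 + c k * p k / (I k + D k * p k)) + μ * (∑ k, q k - P) := by
      rw [sum_add_distrib, ← mul_sum, sum_sub_distrib, hsum]
    _ ≤ _ := by
      linarith [mul_nonneg hμ.le (sub_nonneg.mpr hqsum)]
end

section
/- Let K and L be positive integers, let c_{ik} ≥ 0 for 1 ≤ i ≤ K and 1 ≤ k ≤ L, let e_k > 0 for 1 ≤ k ≤ L, and let P_i > 0 for 1 ≤ i ≤ K. Suppose p* ∈ ℝ^{K×L} satisfies p*_{ik} > 0 for all i, k and ∑_{k=1}^{L} p*_{ik} = P_i for each i, and suppose there exist multipliers μ_i > 0 such that, writing S_k = ∑_{l=1}^{K} c_{lk}·√(p*_{lk}), for all i and k one has c_{ik}·S_k / (√(p*_{ik})·(e_k + S_k²)) = μ_i. Then p* maximizes the function F(p) = ∑_{k=1}^{L} log(1 + (∑_{i=1}^{K} c_{ik}·√(p_{ik}))² / e_k) over the feasible set {p ∈ ℝ^{K×L} : p_{ik} ≥ 0 for all i, k, and ∑_{k=1}^{L} p_{ik} ≤ P_i for each i}. -/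
/-- Tangent-line bound for the square of a nonnegative combination of square roots. -/
theorem sq_sum_mul_sqrt_le {ι : Type*} [Fintype ι] {c p q : ι → ℝ} (hc : ∀ i, 0 ≤ c i)
    (hp : ∀ i, 0 < p i) (hq : ∀ i, 0 ≤ q i) :
    (∑ i, c i * Real.sqrt (q i)) ^ 2 ≤
      (∑ i, c i * Real.sqrt (p i)) * ∑ i, c i * q i / Real.sqrt (p i) := by
  refine Finset.sum_sq_le_sum_mul_sum_of_sq_le_mul _
    (fun i _ => mul_nonneg (hc i) (Real.sqrt_nonneg _))
    (fun i _ => div_nonneg (mul_nonneg (hc i) (hq i)) (Real.sqrt_nonneg _)) fun i _ => le_of_eq ?_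
  have h : Real.sqrt (p i) ≠ 0 := (Real.sqrt_pos.2 (hp i)).ne'
  rw [mul_pow, Real.sq_sqrt (hq i)]
  field_simp

/-- The logarithm `x ↦ log (1 + x / e)` lies below its tangent lines. -/
theorem log_one_add_div_sub_le {e x y : ℝ} (he : 0 < e) (hx : 0 ≤ x) (hy : 0 ≤ y) :
    Real.log (1 + y / e) - Real.log (1 + x / e) ≤ (y - x) / (e + x) := by
  have hx' : 0 < 1 + x / e := by positivity
  have hy' : 0 < 1 + y / e := by positivity
  have hex : e + x ≠ 0 := by positivity
  rw [← Real.log_div hy'.ne' hx'.ne']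
  refine (Real.log_le_sub_one_of_pos (div_pos hy' hx')).trans (le_of_eq ?_)
  field_simp
  ring

/-- The rate of one subcarrier lies below its tangent hyperplane at a point where the
partial derivatives are `μ`. -/
theorem log_rate_sub_le {ι : Type*} [Fintype ι] {c p q μ : ι → ℝ} {e : ℝ}
    (hc : ∀ i, 0 ≤ c i) (he : 0 < e) (hp : ∀ i, 0 < p i) (hq : ∀ i, 0 ≤ q i)
    (hstat : ∀ i, c i * (∑ l, c l * Real.sqrt (p l)) /
      (Real.sqrt (p i) * (e + (∑ l, c l * Real.sqrt (p l)) ^ 2)) = μ i) :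
    Real.log (1 + (∑ i, c i * Real.sqrt (q i)) ^ 2 / e) -
        Real.log (1 + (∑ i, c i * Real.sqrt (p i)) ^ 2 / e) ≤
      ∑ i, μ i * q i - ∑ i, μ i * p i := by
  have hT := sq_sum_mul_sqrt_le hc hp hq
  have hsqrt : ∀ i, Real.sqrt (p i) ≠ 0 := fun i => (Real.sqrt_pos.2 (hp i)).ne'
  refine (log_one_add_div_sub_le he (sq_nonneg _) (sq_nonneg _)).trans ?_
  have hlin (r : ι → ℝ) : ∑ i, μ i * r i =
      (∑ i, c i * Real.sqrt (p i)) * (∑ i, c i * r i / Real.sqrt (p i)) /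
        (e + (∑ i, c i * Real.sqrt (p i)) ^ 2) := by
    rw [Finset.mul_sum, Finset.sum_div]
    refine Finset.sum_congr rfl fun i _ => ?_
    have h := hsqrt i
    have hd : e + (∑ i, c i * Real.sqrt (p i)) ^ 2 ≠ 0 := by positivity
    rw [← hstat i]
    field_simp
  have hself : ∑ i, c i * p i / Real.sqrt (p i) = ∑ i, c i * Real.sqrt (p i) :=
    Finset.sum_congr rfl fun i _ => by rw [mul_div_assoc, Real.div_sqrt]
  rw [hlin q, hlin p, hself, ← sub_div, ← sq]
  gcongr

open Finset in
/-- Sufficiency of the interior KKT conditions for the cloud control unit's power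
allocation: if `p*` is strictly positive, each radio head's budget is met with
equality, and there are multipliers `μ i > 0` satisfying the stationarity
conditions, then `p*` maximizes the cloud sum-rate
`F(p) = ∑ k, log(1 + (∑ i, c i k * √(p i k))² / e k)` over the feasible set. -/
theorem cloud_kkt_sufficient (K L : ℕ) (hK : 0 < K) (hL : 0 < L)
    (c : Fin K → Fin L → ℝ) (hc : ∀ i k, 0 ≤ c i k)
    (e : Fin L → ℝ) (he : ∀ k, 0 < e k)
    (P : Fin K → ℝ) (hP : ∀ i, 0 < P i)
    (p : Fin K → Fin L → ℝ) (hp : ∀ i k, 0 < p i k)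
    (hsum : ∀ i, ∑ k, p i k = P i)
    (μ : Fin K → ℝ) (hμ : ∀ i, 0 < μ i)
    (hstat : ∀ i k,
      c i k * (∑ l, c l k * Real.sqrt (p l k)) /
        (Real.sqrt (p i k) * (e k + (∑ l, c l k * Real.sqrt (p l k)) ^ 2)) = μ i) :
    ∀ q : Fin K → Fin L → ℝ, (∀ i k, 0 ≤ q i k) → (∀ i, ∑ k, q i k ≤ P i) →
      ∑ k, Real.log (1 + (∑ i, c i k * Real.sqrt (q i k)) ^ 2 / e k) ≤
        ∑ k, Real.log (1 + (∑ i, c i k * Real.sqrt (p i k)) ^ 2 / e k) := by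
  intro q hq hqP
  rw [← sub_nonpos, ← Finset.sum_sub_distrib]
  calc _ ≤ ∑ k, (∑ i, μ i * q i k - ∑ i, μ i * p i k) :=
        Finset.sum_le_sum fun k _ => log_rate_sub_le (fun i => hc i k) (he k)
          (fun i => hp i k) (fun i => hq i k) (fun i => hstat i k)
    _ = ∑ i, μ i * (∑ k, q i k - P i) := by
        rw [Finset.sum_sub_distrib, Finset.sum_comm, Finset.sum_comm (f := fun k i => μ i * p i k),
          ← Finset.sum_sub_distrib]
        simp only [← Finset.mul_sum, hsum, mul_sub]
    _ ≤ 0 := Finset.sum_nonpos fun i _ =>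
        mul_nonpos_of_nonneg_of_nonpos (hμ i).le (sub_nonpos.2 (hqP i))
end
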